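/- arXiv:2106.08794 — 3 statements merged into one kernel-verified Lean document; each statement's English description precedes it below -/
import Mathlib

section
/- Let p ∈ (1,∞), p' = p/(p−1), and let b₂, b₃ ≥ 0. Then there exists a constant C ≥ 0, depending only on p, b₂, b₃, with the following property: for all Lebesgue-measurable functions φ, ψ : ℝ → [0,∞) such that (a) ∫_ℝ φ(s)^p ds ≤ 1, (b) ∫_{−∞}^t ψ(s)^{p'} ds ≤ b₂ + t for every t ≥ 0, and (c) e^{t/p} ∫_t^∞ e^{−s/p} ψ(s) ds ≤ b₃ for every t ≥ 0, one has ∫_0^∞ exp(−F(t)) dt ≤ C, where F(t) = t − ( e^t ∫_t^∞ e^{−s/p'} φ(s) ds · ∫_t^∞ e^{−s/p} ψ(s) ds + ∫_{−∞}^t φ(s) ψ(s) ds )^{p'}. -/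
open MeasureTheory Set

/-- The function `F` from the proof of the local Adams inequality:
`F(t) = t − ( e^t ∫_t^∞ e^{−s/p'} φ(s) ds · ∫_t^∞ e^{−s/p} ψ(s) ds + ∫_{−∞}^t φ(s) ψ(s) ds )^{p'}`,
where `p' = p/(p−1)`. -/
noncomputable def adamsF (p : ℝ) (φ ψ : ℝ → ℝ) (t : ℝ) : ℝ :=
  t - (Real.exp t * (∫ s in Ioi t, Real.exp (-s / (p / (p - 1))) * φ s) *
        (∫ s in Ioi t, Real.exp (-s / p) * ψ s) +
      ∫ s in Iic t, φ s * ψ s) ^ (p / (p - 1))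

lemma two_point_holder {p q : ℝ} (hpq : p.HolderConjugate q) {x y α β : ℝ}
    (hx : 0 ≤ x) (hy : 0 ≤ y) (hα : 0 ≤ α) (hβ : 0 ≤ β) :
    x ^ (1 / p) * α ^ (1 / q) + y ^ (1 / p) * β ^ (1 / q) ≤
      (x + y) ^ (1 / p) * (α + β) ^ (1 / q) := by
  have h := Real.inner_le_Lp_mul_Lq_of_nonneg (Finset.univ : Finset (Fin 2))
    (f := ![x ^ (1 / p), y ^ (1 / p)]) (g := ![α ^ (1 / q), β ^ (1 / q)]) hpq
    (by intro i _; fin_cases i <;> simp <;> positivity)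
    (by intro i _; fin_cases i <;> simp <;> positivity)
  simpa [Fin.sum_univ_two, ← Real.rpow_mul, hx, hy, hα, hβ, hpq.ne_zero, hpq.symm.ne_zero] using h

lemma rpow_two_point_le {p q : ℝ} (hpq : p.HolderConjugate q) {x y α β s : ℝ}
    (hx : 0 ≤ x) (hy : 0 ≤ y) (hα : 0 ≤ α) (hβ : 0 ≤ β) (hs : 0 < s) (hs1 : s < 1) :
    (x ^ (1 / p) * α ^ (1 / q) + y ^ (1 / p) * β ^ (1 / q)) ^ q ≤
      (x / s) ^ (q - 1) * α + (y / (1 - s)) ^ (q - 1) * β := by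
  have key : ∀ z γ t : ℝ, 0 ≤ z → 0 ≤ γ → 0 < t →
      t * (z ^ (1 / p) * γ ^ (1 / q) / t) ^ q = (z / t) ^ (q - 1) * γ := by
    intro z γ t hz hγ ht
    have e : 1 / p * q = q - 1 := by
      rw [← hpq.symm.div_conj_eq_sub_one]; ring
    rw [Real.div_rpow (by positivity) ht.le, Real.mul_rpow (by positivity) (by positivity),
      ← Real.rpow_mul hz, ← Real.rpow_mul hγ, e, one_div_mul_cancel hpq.symm.ne_zero,
      Real.rpow_one, Real.div_rpow hz ht.le, Real.rpow_sub_one ht.ne']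
    field_simp
  have hs2 : 0 < 1 - s := by linarith
  have h := (convexOn_rpow hpq.symm.lt.le).2
    (show x ^ (1 / p) * α ^ (1 / q) / s ∈ Ici 0 by simp only [mem_Ici]; positivity)
    (show y ^ (1 / p) * β ^ (1 / q) / (1 - s) ∈ Ici 0 by simp only [mem_Ici]; positivity)
    hs.le hs2.le (by ring)
  simp only [smul_eq_mul] at h
  rw [key _ _ _ hx hα hs, key _ _ _ hy hβ hs2] at h
  rwa [mul_div_cancel₀ _ hs.ne', mul_div_cancel₀ _ hs2.ne'] at h

lemma one_sub_rpow_le {r y : ℝ} (hr : 0 < r) (hy : 0 ≤ y) (hy1 : y ≤ 1) :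
    (1 - y) ^ r ≤ 1 - min 1 r * y := by
  have hm : 0 < min 1 r := lt_min one_pos hr
  calc (1 - y) ^ r ≤ (1 - y) ^ (min 1 r) :=
        Real.rpow_le_rpow_of_exponent_ge' (by linarith) (by linarith) hm.le (min_le_right _ _)
    _ = (1 + -y) ^ (min 1 r) := by ring_nf
    _ ≤ 1 + min 1 r * -y :=
        rpow_one_add_le_one_add_mul_self (by linarith) hm.le (min_le_left _ _)
    _ = _ := by ring

lemma inv_one_sub_rpow_le {r s : ℝ} (hr : 0 ≤ r) (hs : 0 ≤ s) (hs1 : s ≤ 1 / 2) :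
    (1 / (1 - s)) ^ r ≤ 1 + 2 * r * Real.exp r * s := by
  have h1 : 1 / (1 - s) ≤ Real.exp (2 * s) := by
    rw [div_le_iff₀ (by linarith)]
    nlinarith [Real.add_one_le_exp (2 * s)]
  have h2 : (1 / (1 - s)) ^ r ≤ Real.exp (2 * s * r) := by
    rw [Real.exp_mul]
    exact Real.rpow_le_rpow (one_div_nonneg.2 (by linarith)) h1 hr
  have h3 : Real.exp (2 * s * r) ≤ 1 + 2 * s * r * Real.exp (2 * s * r) := by
    have h := Real.add_one_le_exp (-(2 * s * r))
    have h' : Real.exp (2 * s * r) * Real.exp (-(2 * s * r)) = 1 := by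
      rw [← Real.exp_add]; simp
    nlinarith [Real.exp_pos (2 * s * r)]
  have h4 : Real.exp (2 * s * r) ≤ Real.exp r := Real.exp_le_exp.2 (by nlinarith)
  have h5 : 2 * s * r * Real.exp (2 * s * r) ≤ 2 * s * r * Real.exp r :=
    mul_le_mul_of_nonneg_left h4 (by positivity)
  linarith

lemma rpow_le_add_one_sub_mul {p q : ℝ} (hpq : p.HolderConjugate q) {x u D m T : ℝ}
    (hx : 0 ≤ x) (hu : 0 ≤ u) (hux : u + x ≤ 1) (hD : 0 ≤ D) (hm : 0 ≤ m) (hT : 0 ≤ T)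
    (h : T ≤ x ^ (1 / p) * D ^ (1 / q) + u ^ (1 / p) * m ^ (1 / q)) :
    T ^ q ≤ 2 ^ (q - 1) * D + (1 - min 1 (q - 1) / 2 * x) * m := by
  have hr : 0 < q - 1 := hpq.symm.sub_one_pos
  have hTq := Real.rpow_le_rpow hT h hpq.symm.nonneg
  rcases hx.eq_or_lt with rfl | hx
  · rw [Real.zero_rpow hpq.one_div_ne_zero, zero_mul, zero_add] at hTq
    rw [Real.mul_rpow (by positivity) (by positivity), ← Real.rpow_mul hm,
      one_div_mul_cancel hpq.symm.ne_zero, Real.rpow_one] at hTq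
    have : (u ^ (1 / p)) ^ q ≤ 1 :=
      Real.rpow_le_one (by positivity) (Real.rpow_le_one hu (by linarith) hpq.one_div_nonneg)
        hpq.symm.nonneg
    have h2 : 0 ≤ (2 : ℝ) ^ (q - 1) * D := by positivity
    nlinarith
  · have hx1 : x ≤ 1 := by linarith
    have hs := rpow_two_point_le hpq hx.le hu hD hm (half_pos hx) (by linarith)
    have e : x / (x / 2) = 2 := by field_simp
    have h1 : (u / (1 - x / 2)) ^ (q - 1) ≤ 1 - min 1 (q - 1) * (x / 2) := by
      refine le_trans (Real.rpow_le_rpow (div_nonneg hu (by linarith)) ?_ hr.le)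
        (one_sub_rpow_le hr (by linarith) (by linarith))
      rw [div_le_iff₀ (by linarith)]
      nlinarith
    rw [e] at hs
    have := mul_le_mul_of_nonneg_right h1 hm
    calc _ ≤ _ := hTq
      _ ≤ _ := hs
      _ ≤ _ := by linarith

lemma rpow_le_add_of_le {p q : ℝ} (hpq : p.HolderConjugate q) {x u D m T : ℝ}
    (hx : 0 ≤ x) (hu : 0 ≤ u) (hux : u + x ≤ 1) (hD : 0 ≤ D) (hm : 0 ≤ m) (hT : 0 ≤ T)
    (h : T ≤ x ^ (1 / p) * D ^ (1 / q) + u ^ (1 / p) * m ^ (1 / q)) :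
    T ^ q ≤ D + m := by
  have h1 : T ≤ (D + m) ^ (1 / q) := by
    refine (h.trans (two_point_holder hpq hx hu hD hm)).trans ?_
    exact mul_le_of_le_one_left (by positivity)
      (Real.rpow_le_one (by positivity) (by linarith) hpq.one_div_nonneg)
  have h2 := Real.rpow_le_rpow hT h1 hpq.symm.nonneg
  rwa [← Real.rpow_mul (by positivity), one_div_mul_cancel hpq.symm.ne_zero, Real.rpow_one] at h2

/-- Two points `t₁ ≤ t₂` of a sublevel set `{t | t - T(t) ^ q ≤ lam}`, with `t₁` large compared
to `lam`, are at distance at most a constant times `lam + b + 2 ^ (q - 1) * D`. -/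
lemma sublevel_gap_le {p q : ℝ} (hpq : p.HolderConjugate q)
    {b D lam t₁ t₂ u x m₁ m₂ T₁ T₂ : ℝ}
    (hb : 0 ≤ b) (hD : 0 ≤ D) (hlam : 0 < lam)
    (hu : 0 ≤ u) (hx : 0 ≤ x) (hux : u + x ≤ 1)
    (hm₁ : 0 ≤ m₁) (hm₁b : m₁ ≤ b + t₁) (hm : m₁ ≤ m₂) (hm₂b : m₂ ≤ b + t₂)
    (hT₁ : 0 ≤ T₁) (hT₂ : 0 ≤ T₂)
    (h₁ : T₁ ≤ x ^ (1 / p) * D ^ (1 / q) + u ^ (1 / p) * m₁ ^ (1 / q))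
    (h₂ : T₂ ≤ x ^ (1 / p) * (D + (m₂ - m₁)) ^ (1 / q) + u ^ (1 / p) * m₁ ^ (1 / q))
    (hl₁ : t₁ - lam ≤ T₁ ^ q) (hl₂ : t₂ - lam ≤ T₂ ^ q)
    (hlarge : 2 * (2 ^ (1 / (q - 1)) * (lam + b + 2 ^ (q - 1) * D) / (min 1 (q - 1) / 2)) ≤
      b + t₁) :
    t₂ - t₁ ≤ (4 * (q - 1) * Real.exp (q - 1) * 2 ^ (1 / (q - 1)) / (min 1 (q - 1) / 2) + 3) *
      (lam + b + 2 ^ (q - 1) * D) := by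
  have hr : 0 < q - 1 := hpq.symm.sub_one_pos
  set r := q - 1 with hrdef
  set c := min 1 r / 2 with hc
  have hcpos : 0 < c := half_pos (lt_min one_pos hr)
  have hc1 : c ≤ 1 / 2 := by
    have := min_le_left 1 r
    linarith
  set N : ℝ := 2 ^ (1 / r) with hN
  have hNpos : 0 < N := by positivity
  have hNr : N ^ r = 2 := by
    rw [hN, ← Real.rpow_mul (by norm_num), one_div_mul_cancel hr.ne', Real.rpow_one]
  have h2r : (1 : ℝ) ≤ 2 ^ r := Real.one_le_rpow (by norm_num) hr.le
  set K := lam + b + 2 ^ r * D with hK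
  have hKD : D ≤ 2 ^ r * D := le_mul_of_one_le_left hD h2r
  have hKpos : 0 < K := by positivity
  have hup := rpow_le_add_of_le hpq hx hu hux hD hm₁ hT₁ h₁
  have hmass := rpow_le_add_one_sub_mul hpq hx hu hux hD hm₁ hT₁ h₁
  rw [← hrdef, ← hc] at hmass
  have hpos : 0 < b + t₁ := lt_of_lt_of_le (by positivity) hlarge
  have hcx : c * x * (b + t₁) ≤ K := by
    have hnn : 0 ≤ 1 - c * x := by nlinarith
    have := mul_le_mul_of_nonneg_left hm₁b hnn
    linarith
  set s := N * K / c / (b + t₁) with hs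
  have hspos : 0 < s := by positivity
  have hs_half : s ≤ 1 / 2 := by
    rw [hs, div_le_iff₀ hpos]; linarith
  have hsmul : s * (b + t₁) = N * K / c := by rw [hs]; field_simp
  have hxs : (x / s) ^ r ≤ 1 / 2 := by
    have h1 : x / s ≤ 1 / N := by
      rw [div_le_div_iff₀ hspos hNpos, one_mul]
      have h3 : x ≤ K / c / (b + t₁) := by
        rw [le_div_iff₀ hpos, le_div_iff₀ hcpos]; linarith
      calc x * N ≤ K / c / (b + t₁) * N := mul_le_mul_of_nonneg_right h3 hNpos.le
        _ = s := by rw [hs]; ring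
    refine (Real.rpow_le_rpow (by positivity) h1 hr.le).trans ?_
    rw [Real.div_rpow one_pos.le hNpos.le, hNr, Real.one_rpow]
  have hus : (u / (1 - s)) ^ r ≤ 1 + 2 * r * Real.exp r * s := by
    refine le_trans (Real.rpow_le_rpow (div_nonneg hu (by linarith)) ?_ hr.le)
      (inv_one_sub_rpow_le hr.le hspos.le hs_half)
    exact div_le_div_of_nonneg_right (by linarith) (by linarith)
  have hDm : 0 ≤ D + (m₂ - m₁) := by linarith
  have hfin := (Real.rpow_le_rpow hT₂ h₂ hpq.symm.nonneg).trans
    (rpow_two_point_le hpq hx hu hDm hm₁ hspos (by linarith))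
  rw [← hrdef] at hfin
  have e1 := mul_le_mul_of_nonneg_right hxs hDm
  have e2 := mul_le_mul hus hm₁b hm₁ (by positivity)
  have e3 : (1 + 2 * r * Real.exp r * s) * (b + t₁) =
      b + t₁ + 2 * r * Real.exp r * (N * K / c) := by
    rw [← hsmul]; ring
  have e4 : 4 * r * Real.exp r * N / c * K = 2 * (2 * r * Real.exp r * (N * K / c)) := by ring
  rw [add_mul, e4]
  rw [e3] at e2
  linarith

lemma setLIntegral_ofReal_mul_le {p q : ℝ} (hpq : p.HolderConjugate q) {f g : ℝ → ℝ}
    (hf : Measurable f) (hg : Measurable g) (hf0 : ∀ s, 0 ≤ f s) (hg0 : ∀ s, 0 ≤ g s) (S : Set ℝ) :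
    (∫⁻ s in S, ENNReal.ofReal (f s * g s)) ≤
      (∫⁻ s in S, ENNReal.ofReal (f s ^ p)) ^ (1 / p) *
        (∫⁻ s in S, ENNReal.ofReal (g s ^ q)) ^ (1 / q) := by
  have h := ENNReal.lintegral_mul_le_Lp_mul_Lq (volume.restrict S) hpq
    hf.ennreal_ofReal.aemeasurable hg.ennreal_ofReal.aemeasurable
  simpa only [Pi.mul_apply, ← ENNReal.ofReal_mul (hf0 _),
    ENNReal.ofReal_rpow_of_nonneg (hf0 _) hpq.nonneg,
    ENNReal.ofReal_rpow_of_nonneg (hg0 _) hpq.symm.nonneg] using h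

lemma integrableOn_mul_of_lintegral_ne_top {p q : ℝ} (hpq : p.HolderConjugate q) {f g : ℝ → ℝ}
    (hf : Measurable f) (hg : Measurable g) (hf0 : ∀ s, 0 ≤ f s) (hg0 : ∀ s, 0 ≤ g s) {S : Set ℝ}
    (hfS : (∫⁻ s in S, ENNReal.ofReal (f s ^ p)) ≠ ⊤)
    (hgS : (∫⁻ s in S, ENNReal.ofReal (g s ^ q)) ≠ ⊤) :
    IntegrableOn (fun s => f s * g s) S := by
  refine ⟨(hf.mul hg).aestronglyMeasurable, ?_⟩
  rw [hasFiniteIntegral_iff_ofReal (Filter.Eventually.of_forall fun s =>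
    mul_nonneg (hf0 s) (hg0 s))]
  exact (setLIntegral_ofReal_mul_le hpq hf hg hf0 hg0 S).trans_lt
    (ENNReal.mul_lt_top (ENNReal.rpow_lt_top_of_nonneg hpq.one_div_nonneg hfS)
      (ENNReal.rpow_lt_top_of_nonneg hpq.symm.one_div_nonneg hgS))

lemma setIntegral_mul_le {p q : ℝ} (hpq : p.HolderConjugate q) {f g : ℝ → ℝ}
    (hf : Measurable f) (hg : Measurable g) (hf0 : ∀ s, 0 ≤ f s) (hg0 : ∀ s, 0 ≤ g s) {S : Set ℝ}
    (hfS : (∫⁻ s in S, ENNReal.ofReal (f s ^ p)) ≠ ⊤)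
    (hgS : (∫⁻ s in S, ENNReal.ofReal (g s ^ q)) ≠ ⊤) :
    (∫ s in S, f s * g s) ≤
      (∫⁻ s in S, ENNReal.ofReal (f s ^ p)).toReal ^ (1 / p) *
        (∫⁻ s in S, ENNReal.ofReal (g s ^ q)).toReal ^ (1 / q) := by
  rw [integral_eq_lintegral_of_nonneg_ae
    (Filter.Eventually.of_forall fun s => mul_nonneg (hf0 s) (hg0 s))
    (hf.mul hg).aestronglyMeasurable, ENNReal.toReal_rpow, ENNReal.toReal_rpow,
    ← ENNReal.toReal_mul]
  exact ENNReal.toReal_mono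
    (ENNReal.mul_lt_top (ENNReal.rpow_lt_top_of_nonneg hpq.one_div_nonneg hfS)
      (ENNReal.rpow_lt_top_of_nonneg hpq.symm.one_div_nonneg hgS)).ne
    (setLIntegral_ofReal_mul_le hpq hf hg hf0 hg0 S)

lemma setIntegral_Ioi_exp_mul_le {p q : ℝ} (hpq : p.HolderConjugate q) {f : ℝ → ℝ}
    (hf : Measurable f) (hf0 : ∀ s, 0 ≤ f s) (t : ℝ)
    (hft : (∫⁻ s in Ioi t, ENNReal.ofReal (f s ^ p)) ≠ ⊤) :
    (∫ s in Ioi t, Real.exp (-s / q) * f s) ≤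
      (∫⁻ s in Ioi t, ENNReal.ofReal (f s ^ p)).toReal ^ (1 / p) * Real.exp (-t / q) := by
  have e : (∫⁻ s in Ioi t, ENNReal.ofReal (Real.exp (-s / q) ^ q)) =
      ENNReal.ofReal (Real.exp (-t)) := by
    simp only [← Real.exp_mul, div_mul_cancel₀ _ hpq.symm.ne_zero]
    rw [← ofReal_integral_eq_lintegral_ofReal (integrableOn_exp_neg_Ioi t)
      (Filter.Eventually.of_forall fun s => (Real.exp_pos _).le), integral_exp_neg_Ioi]
  have h := setIntegral_mul_le hpq hf (g := fun s => Real.exp (-s / q)) (by fun_prop) hf0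
    (fun s => (Real.exp_pos _).le) hft (by rw [e]; exact ENNReal.ofReal_ne_top)
  rw [e, ENNReal.toReal_ofReal (Real.exp_pos _).le, ← Real.exp_mul, mul_one_div] at h
  simpa only [mul_comm] using h

lemma exp_mul_setIntegral_Ioi_le {p b : ℝ} {ψ : ℝ → ℝ} (hψ : Measurable ψ) (hψ0 : ∀ s, 0 ≤ ψ s)
    (hb : 0 ≤ b) (t : ℝ)
    (h : ENNReal.ofReal (Real.exp (t / p)) *
      (∫⁻ s in Ioi t, ENNReal.ofReal (Real.exp (-s / p) * ψ s)) ≤ ENNReal.ofReal b) :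
    Real.exp (t / p) * (∫ s in Ioi t, Real.exp (-s / p) * ψ s) ≤ b := by
  have h' := ENNReal.toReal_le_of_le_ofReal hb h
  rwa [ENNReal.toReal_mul, ENNReal.toReal_ofReal (Real.exp_pos _).le,
    ← integral_eq_lintegral_of_nonneg_ae
      (Filter.Eventually.of_forall fun s => mul_nonneg (Real.exp_pos _).le (hψ0 s))
      (Measurable.aestronglyMeasurable (by fun_prop))] at h'

lemma toReal_setLIntegral_Iic_add_Ioc {f : ℝ → ENNReal} {a b : ℝ} (hab : a ≤ b)
    (hf : (∫⁻ s in Iic b, f s) ≠ ⊤) :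
    (∫⁻ s in Iic b, f s).toReal =
      (∫⁻ s in Iic a, f s).toReal + (∫⁻ s in Ioc a b, f s).toReal := by
  rw [← Iic_union_Ioc_eq_Iic hab] at hf ⊢
  rw [lintegral_union measurableSet_Ioc (Iic_disjoint_Ioc le_rfl)] at hf ⊢
  rw [ENNReal.add_ne_top] at hf
  exact ENNReal.toReal_add hf.1 hf.2

lemma toReal_setLIntegral_Iic_add_Ioi {f : ℝ → ENNReal} (a : ℝ) (hf : (∫⁻ s, f s) ≠ ⊤) :
    (∫⁻ s in Iic a, f s).toReal + (∫⁻ s in Ioi a, f s).toReal = (∫⁻ s, f s).toReal := by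
  have h := lintegral_add_compl (μ := volume) f (measurableSet_Iic (a := a))
  rw [compl_Iic] at h
  rw [← h, ENNReal.add_ne_top] at hf
  rw [← h, ENNReal.toReal_add hf.1 hf.2]

lemma volume_le_of_gap_le {S : Set ℝ} {R L : ℝ} (hS : ∀ t ∈ S, 0 ≤ t)
    (h : ∀ t₁ ∈ S, ∀ t₂ ∈ S, t₁ ≤ t₂ → R ≤ t₁ → t₂ - t₁ ≤ L) :
    volume S ≤ ENNReal.ofReal R + ENNReal.ofReal L := by
  have hsub : S ⊆ Icc 0 R ∪ (S ∩ Ici R) := by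
    intro t ht
    rcases le_total t R with h' | h'
    · exact Or.inl ⟨hS t ht, h'⟩
    · exact Or.inr ⟨ht, h'⟩
  refine (measure_mono hsub).trans ((measure_union_le _ _).trans (add_le_add ?_ ?_))
  · simp
  · refine (Real.volume_le_diam _).trans (Metric.ediam_le ?_)
    rintro a ⟨ha, haR⟩ b ⟨hb, hbR⟩
    rw [edist_dist, Real.dist_eq]
    refine ENNReal.ofReal_le_ofReal ?_
    rcases le_total a b with hab | hab
    · rw [abs_sub_comm, abs_of_nonneg (by linarith)]
      exact h a ha b hb hab haR
    · rw [abs_of_nonneg (by linarith)]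
      exact h b hb a ha hab hbR

lemma lintegral_exp_neg_le_of_volume_sublevel_le {F : ℝ → ℝ} {d A κ : ℝ} (hd : 0 ≤ d)
    (hA : 0 ≤ A) (hκ : 0 ≤ κ) (hF : ∀ t, 0 ≤ t → -d ≤ F t)
    (hvol : ∀ n : ℕ, volume {t | 0 ≤ t ∧ F t ≤ n + 1} ≤ ENNReal.ofReal (A * (n + 1 + κ))) :
    (∫⁻ t in Ioi (0 : ℝ), ENNReal.ofReal (Real.exp (-(F t)))) ≤
      ENNReal.ofReal (∑' n : ℕ, Real.exp (d - n) * (A * (n + 1 + κ))) := by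
  have hsum : Summable fun n : ℕ => Real.exp (d - n) * (A * (n + 1 + κ)) := by
    have h0 := Real.summable_pow_mul_exp_neg_nat_mul 0 one_pos
    have h1 := Real.summable_pow_mul_exp_neg_nat_mul 1 one_pos
    refine ((h1.mul_left (Real.exp d * A)).add
      (h0.mul_left (Real.exp d * A * (1 + κ)))).congr fun n => ?_
    rw [sub_eq_add_neg, Real.exp_add]
    simp only [pow_one, pow_zero, neg_mul, one_mul]
    ring
  rw [ENNReal.ofReal_tsum_of_nonneg (fun n => by positivity) hsum]
  have hcover : Ioi (0 : ℝ) ⊆ ⋃ n : ℕ, {t | 0 ≤ t ∧ n ≤ F t + d ∧ F t + d < n + 1} := by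
    intro t ht
    have ht0 : 0 ≤ t := le_of_lt ht
    have hnn : 0 ≤ F t + d := by linarith [hF t ht0]
    exact mem_iUnion.2 ⟨⌊F t + d⌋₊, ht0, Nat.floor_le hnn, Nat.lt_floor_add_one _⟩
  refine (lintegral_mono_set hcover).trans ((lintegral_iUnion_le _ _).trans
    (ENNReal.tsum_le_tsum fun n => ?_))
  calc _ ≤ ∫⁻ t in {t | 0 ≤ t ∧ n ≤ F t + d ∧ F t + d < n + 1},
          ENNReal.ofReal (Real.exp (d - n)) := by
        refine setLIntegral_mono measurable_const fun t ht => ?_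
        exact ENNReal.ofReal_le_ofReal (Real.exp_le_exp.2 (by linarith [ht.2.1]))
    _ ≤ ENNReal.ofReal (Real.exp (d - n)) * ENNReal.ofReal (A * (n + 1 + κ)) := by
        rw [setLIntegral_const]
        gcongr
        refine (measure_mono ?_).trans (hvol n)
        rintro t ⟨h0, -, h2⟩
        exact ⟨h0, by linarith⟩
    _ = _ := (ENNReal.ofReal_mul (Real.exp_pos _).le).symm

lemma adams_bracket_le {p q b₃ : ℝ} (hpq : p.HolderConjugate q) (hb₃ : 0 ≤ b₃) {φ ψ : ℝ → ℝ}
    (hφ : Measurable φ) (hψ : Measurable ψ) (hφ0 : ∀ s, 0 ≤ φ s) (hψ0 : ∀ s, 0 ≤ ψ s)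
    (hφp : (∫⁻ s, ENNReal.ofReal (φ s ^ p)) ≠ ⊤) {t₁ t₂ : ℝ} (ht : t₁ ≤ t₂)
    (hψq : (∫⁻ s in Iic t₂, ENNReal.ofReal (ψ s ^ q)) ≠ ⊤)
    (hψt : ENNReal.ofReal (Real.exp (t₂ / p)) *
      (∫⁻ s in Ioi t₂, ENNReal.ofReal (Real.exp (-s / p) * ψ s)) ≤ ENNReal.ofReal b₃) :
    Real.exp t₂ * (∫ s in Ioi t₂, Real.exp (-s / q) * φ s) *
        (∫ s in Ioi t₂, Real.exp (-s / p) * ψ s) + ∫ s in Iic t₂, φ s * ψ s ≤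
      (∫⁻ s in Ioi t₁, ENNReal.ofReal (φ s ^ p)).toReal ^ (1 / p) *
          (b₃ ^ q + ((∫⁻ s in Iic t₂, ENNReal.ofReal (ψ s ^ q)).toReal -
            (∫⁻ s in Iic t₁, ENNReal.ofReal (ψ s ^ q)).toReal)) ^ (1 / q) +
        (∫⁻ s in Iic t₁, ENNReal.ofReal (φ s ^ p)).toReal ^ (1 / p) *
          (∫⁻ s in Iic t₁, ENNReal.ofReal (ψ s ^ q)).toReal ^ (1 / q) := by
  have hφS : ∀ S : Set ℝ, (∫⁻ s in S, ENNReal.ofReal (φ s ^ p)) ≠ ⊤ := fun S =>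
    ne_top_of_le_ne_top hφp (setLIntegral_le_lintegral _ _)
  have hψS : ∀ S : Set ℝ, S ⊆ Iic t₂ → (∫⁻ s in S, ENNReal.ofReal (ψ s ^ q)) ≠ ⊤ := fun S hS =>
    ne_top_of_le_ne_top hψq (lintegral_mono_set hS)
  have hIic := setIntegral_mul_le hpq hφ hψ hφ0 hψ0 (hφS (Iic t₁)) (hψS _ (Iic_subset_Iic.2 ht))
  have hIoc := setIntegral_mul_le hpq hφ hψ hφ0 hψ0 (hφS (Ioc t₁ t₂)) (hψS _ Ioc_subset_Iic_self)
  have hint := integrableOn_mul_of_lintegral_ne_top hpq hφ hψ hφ0 hψ0 (hφS (Iic t₂)) hψq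
  have hsplit : ∫ s in Iic t₂, φ s * ψ s =
      (∫ s in Iic t₁, φ s * ψ s) + ∫ s in Ioc t₁ t₂, φ s * ψ s := by
    rw [← Iic_union_Ioc_eq_Iic ht, setIntegral_union (Iic_disjoint_Ioc le_rfl) measurableSet_Ioc
      (hint.mono_set (Iic_subset_Iic.2 ht)) (hint.mono_set Ioc_subset_Iic_self)]
  have hI := setIntegral_Ioi_exp_mul_le hpq hφ hφ0 t₂ (hφS _)
  have hJ := exp_mul_setIntegral_Ioi_le hψ hψ0 hb₃ t₂ hψt
  have hm := toReal_setLIntegral_Iic_add_Ioc ht hψq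
  have hu := toReal_setLIntegral_Iic_add_Ioc ht (hφS (Iic t₂))
  have hux₁ := toReal_setLIntegral_Iic_add_Ioi t₁ hφp
  have hux₂ := toReal_setLIntegral_Iic_add_Ioi t₂ hφp
  set x₁ := (∫⁻ s in Ioi t₁, ENNReal.ofReal (φ s ^ p)).toReal
  set x₂ := (∫⁻ s in Ioi t₂, ENNReal.ofReal (φ s ^ p)).toReal
  set y := (∫⁻ s in Ioc t₁ t₂, ENNReal.ofReal (φ s ^ p)).toReal
  set n := (∫⁻ s in Ioc t₁ t₂, ENNReal.ofReal (ψ s ^ q)).toReal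
  have hx₂0 : 0 ≤ x₂ := ENNReal.toReal_nonneg
  have hy0 : 0 ≤ y := ENNReal.toReal_nonneg
  have hn0 : 0 ≤ n := ENNReal.toReal_nonneg
  have hJ0 : 0 ≤ ∫ s in Ioi t₂, Real.exp (-s / p) * ψ s :=
    integral_nonneg fun s => mul_nonneg (Real.exp_pos _).le (hψ0 s)
  have hexp : Real.exp t₂ * Real.exp (-t₂ / q) = Real.exp (t₂ / p) := by
    rw [← Real.exp_add]
    congr 1
    have := hpq.inv_add_inv_eq_one
    rw [div_eq_mul_inv, div_eq_mul_inv]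
    linear_combination -t₂ * this
  have hfirst : Real.exp t₂ * (∫ s in Ioi t₂, Real.exp (-s / q) * φ s) *
      (∫ s in Ioi t₂, Real.exp (-s / p) * ψ s) ≤ x₂ ^ (1 / p) * (b₃ ^ q) ^ (1 / q) := by
    rw [← Real.rpow_mul hb₃, mul_one_div_cancel hpq.symm.ne_zero, Real.rpow_one]
    calc _ ≤ Real.exp t₂ * (x₂ ^ (1 / p) * Real.exp (-t₂ / q)) *
          (∫ s in Ioi t₂, Real.exp (-s / p) * ψ s) := by gcongr
      _ = x₂ ^ (1 / p) * (Real.exp (t₂ / p) * ∫ s in Ioi t₂, Real.exp (-s / p) * ψ s) := by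
          rw [← hexp]; ring
      _ ≤ _ := by gcongr
  have hpair := two_point_holder hpq hx₂0 hy0 (Real.rpow_nonneg hb₃ q) hn0
  have e1 : x₂ + y = x₁ := by linarith
  have e2 : b₃ ^ q + n = b₃ ^ q + ((∫⁻ s in Iic t₂, ENNReal.ofReal (ψ s ^ q)).toReal -
      (∫⁻ s in Iic t₁, ENNReal.ofReal (ψ s ^ q)).toReal) := by linarith
  rw [e1, e2] at hpair
  rw [hsplit]
  linarith

/-- One-dimensional Adams-type lemma: `∫_0^∞ exp(−F(t)) dt ≤ C` with `C = C(p, b₂, b₃)`. -/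
theorem adams_lemma_exp_integral (p b₂ b₃ : ℝ) (hp : 1 < p) (hb₂ : 0 ≤ b₂) (hb₃ : 0 ≤ b₃) :
    ∃ C : ℝ, 0 ≤ C ∧ ∀ φ ψ : ℝ → ℝ, Measurable φ → Measurable ψ →
      (∀ s, 0 ≤ φ s) → (∀ s, 0 ≤ ψ s) →
      (∫⁻ s, ENNReal.ofReal (φ s ^ p)) ≤ 1 →
      (∀ t : ℝ, 0 ≤ t →
        (∫⁻ s in Iic t, ENNReal.ofReal (ψ s ^ (p / (p - 1)))) ≤ ENNReal.ofReal (b₂ + t)) →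
      (∀ t : ℝ, 0 ≤ t →
        ENNReal.ofReal (Real.exp (t / p)) *
          (∫⁻ s in Ioi t, ENNReal.ofReal (Real.exp (-s / p) * ψ s)) ≤ ENNReal.ofReal b₃) →
      (∫⁻ t in Ioi (0 : ℝ), ENNReal.ofReal (Real.exp (-(adamsF p φ ψ t)))) ≤
        ENNReal.ofReal C := by
  have hpq : p.HolderConjugate (p / (p - 1)) := Real.HolderConjugate.conjExponent hp
  simp only [adamsF]
  set q := p / (p - 1)
  have hr : 0 < q - 1 := hpq.symm.sub_one_pos
  have hc : 0 < min 1 (q - 1) / 2 := half_pos (lt_min one_pos hr)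
  have hD : 0 ≤ b₃ ^ q := Real.rpow_nonneg hb₃ q
  set N : ℝ := 2 * (2 ^ (1 / (q - 1)) / (min 1 (q - 1) / 2)) with hN
  set L : ℝ := 4 * (q - 1) * Real.exp (q - 1) * 2 ^ (1 / (q - 1)) / (min 1 (q - 1) / 2) + 3
    with hL
  set κ : ℝ := b₂ + 2 ^ (q - 1) * b₃ ^ q with hκ
  have hN0 : 0 ≤ N := by positivity
  have hL0 : 0 ≤ L := by positivity
  have hκ0 : 0 ≤ κ := by positivity
  refine ⟨∑' n : ℕ, Real.exp (b₃ ^ q + b₂ - n) * ((N + L) * (n + 1 + κ)),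
    tsum_nonneg fun n => by positivity, ?_⟩
  intro φ ψ hφ hψ hφ0 hψ0 hφp hψq hψt
  have hφfin : (∫⁻ s, ENNReal.ofReal (φ s ^ p)) ≠ ⊤ := ne_top_of_le_ne_top ENNReal.one_ne_top hφp
  have hψfin : ∀ t, 0 ≤ t → (∫⁻ s in Iic t, ENNReal.ofReal (ψ s ^ q)) ≠ ⊤ := fun t ht =>
    ne_top_of_le_ne_top ENNReal.ofReal_ne_top (hψq t ht)
  have hm : ∀ t, 0 ≤ t → (∫⁻ s in Iic t, ENNReal.ofReal (ψ s ^ q)).toReal ≤ b₂ + t := fun t ht =>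
    ENNReal.toReal_le_of_le_ofReal (by positivity) (hψq t ht)
  have hux : ∀ t, (∫⁻ s in Iic t, ENNReal.ofReal (φ s ^ p)).toReal +
      (∫⁻ s in Ioi t, ENNReal.ofReal (φ s ^ p)).toReal ≤ 1 := fun t => by
    rw [toReal_setLIntegral_Iic_add_Ioi t hφfin]
    exact ENNReal.toReal_le_of_le_ofReal zero_le_one (by simpa using hφp)
  have hbracket := fun t₁ t₂ (ht₁ : 0 ≤ t₁) (ht : t₁ ≤ t₂) =>
    adams_bracket_le hpq hb₃ hφ hψ hφ0 hψ0 hφfin ht (hψfin t₂ (ht₁.trans ht))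
      (hψt t₂ (ht₁.trans ht))
  have hT0 : ∀ t, 0 ≤ Real.exp t * (∫ s in Ioi t, Real.exp (-s / q) * φ s) *
        (∫ s in Ioi t, Real.exp (-s / p) * ψ s) + ∫ s in Iic t, φ s * ψ s := fun t =>
    add_nonneg (mul_nonneg (mul_nonneg (Real.exp_pos _).le
      (integral_nonneg fun s => mul_nonneg (Real.exp_pos _).le (hφ0 s)))
      (integral_nonneg fun s => mul_nonneg (Real.exp_pos _).le (hψ0 s)))
      (integral_nonneg fun s => mul_nonneg (hφ0 s) (hψ0 s))
  have hdiag := fun t (ht : 0 ≤ t) => hbracket t t ht le_rfl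
  simp only [sub_self, add_zero] at hdiag
  refine lintegral_exp_neg_le_of_volume_sublevel_le (by positivity) (by positivity) hκ0 ?_ ?_
  · intro t ht
    have := rpow_le_add_of_le hpq ENNReal.toReal_nonneg ENNReal.toReal_nonneg (hux t) hD
      ENNReal.toReal_nonneg (hT0 t) (hdiag t ht)
    linarith [hm t ht]
  · intro n
    have hK0 : 0 ≤ (n : ℝ) + 1 + κ := by positivity
    have hK : (n : ℝ) + 1 + b₂ + 2 ^ (q - 1) * b₃ ^ q = n + 1 + κ := by rw [hκ]; ring
    rw [add_mul, ENNReal.ofReal_add (by positivity) (by positivity)]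
    refine volume_le_of_gap_le (fun t ht => ht.1) ?_
    rintro t₁ ⟨ht₁, hl₁⟩ t₂ ⟨ht₂, hl₂⟩ ht hlarge
    have hmono : (∫⁻ s in Iic t₁, ENNReal.ofReal (ψ s ^ q)).toReal ≤
        (∫⁻ s in Iic t₂, ENNReal.ofReal (ψ s ^ q)).toReal :=
      ENNReal.toReal_mono (hψfin t₂ ht₂) (lintegral_mono_set (Iic_subset_Iic.2 ht))
    have hgap := sublevel_gap_le hpq (lam := n + 1) (t₁ := t₁) (t₂ := t₂) hb₂ hD (by positivity)
      ENNReal.toReal_nonneg ENNReal.toReal_nonneg (hux t₁) ENNReal.toReal_nonneg (hm t₁ ht₁) hmono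
      (hm t₂ ht₂) (hT0 t₁) (hT0 t₂) (hdiag t₁ ht₁) (hbracket t₁ t₂ ht₁ ht)
      (by linarith) (by linarith) (by
        rw [hK]
        calc _ = N * (n + 1 + κ) := by rw [hN]; ring
          _ ≤ b₂ + t₁ := by linarith)
    rwa [hK] at hgap
end

section
/- Let p ∈ (1,∞), p' = p/(p−1), and let b₂, b₃ ≥ 0. Then there exists a constant c ≥ 0, depending only on p, b₂, b₃, with the following property: for all Lebesgue-measurable functions φ, ψ : ℝ → [0,∞) such that (a) ∫_ℝ φ(s)^p ds ≤ 1, (b) ∫_{−∞}^t ψ(s)^{p'} ds ≤ b₂ + t for every t ≥ 0, and (c) e^{t/p} ∫_t^∞ e^{−s/p} ψ(s) ds ≤ b₃ for every t ≥ 0, one has F(t) ≥ −c for every t ≥ 0, where F(t) = t − ( e^t ∫_t^∞ e^{−s/p'} φ(s) ds · ∫_t^∞ e^{−s/p} ψ(s) ds + ∫_{−∞}^t φ(s) ψ(s) ds )^{p'}. -/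
open MeasureTheory Set

/-- Hölder's inequality for nonnegative real functions, with the norms bounded through their
lower Lebesgue integrals. -/
theorem integral_mul_le_of_lintegral_rpow_le {α : Type*} [MeasurableSpace α] {μ : Measure α}
    {p q : ℝ} (hpq : p.HolderConjugate q) {f g : α → ℝ} (hf : Measurable f) (hg : Measurable g)
    (hf₀ : ∀ x, 0 ≤ f x) (hg₀ : ∀ x, 0 ≤ g x) {A B : ℝ} (hA : 0 ≤ A) (hB : 0 ≤ B)
    (hfA : ∫⁻ x, ENNReal.ofReal (f x ^ p) ∂μ ≤ ENNReal.ofReal A)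
    (hgB : ∫⁻ x, ENNReal.ofReal (g x ^ q) ∂μ ≤ ENNReal.ofReal B) :
    ∫ x, f x * g x ∂μ ≤ A ^ (1 / p) * B ^ (1 / q) := by
  have hp := hpq.pos
  have hq := hpq.symm.pos
  rw [integral_eq_lintegral_of_nonneg_ae (.of_forall fun x => mul_nonneg (hf₀ x) (hg₀ x))
    (hf.mul hg).aestronglyMeasurable]
  refine ENNReal.toReal_le_of_le_ofReal (by positivity) ?_
  have holder := ENNReal.lintegral_mul_le_Lp_mul_Lq μ hpq
    hf.ennreal_ofReal.aemeasurable hg.ennreal_ofReal.aemeasurable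
  simp only [Pi.mul_apply, ENNReal.ofReal_rpow_of_nonneg (hf₀ _) hp.le,
    ENNReal.ofReal_rpow_of_nonneg (hg₀ _) hq.le, ← ENNReal.ofReal_mul (hf₀ _)] at holder
  refine holder.trans ?_
  rw [ENNReal.ofReal_mul (by positivity), ← ENNReal.ofReal_rpow_of_nonneg hA (by positivity),
    ← ENNReal.ofReal_rpow_of_nonneg hB (by positivity)]
  gcongr

theorem lintegral_exp_neg_div_rpow_Ioi {q : ℝ} (hq : q ≠ 0) (t : ℝ) :
    ∫⁻ s in Ioi t, ENNReal.ofReal (Real.exp (-s / q) ^ q) = ENNReal.ofReal (Real.exp (-t)) := by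
  simp_rw [← Real.exp_mul, div_mul_cancel₀ _ hq]
  rw [← ofReal_integral_eq_lintegral_ofReal (integrableOn_exp_neg_Ioi t)
    (.of_forall fun s => (Real.exp_pos _).le), integral_exp_neg_Ioi]

/-- Hölder's inequality for two summands, with weights of total mass at most one. -/
theorem rpow_mul_add_rpow_mul_rpow_le {p q : ℝ} (hpq : p.HolderConjugate q) {a b x y : ℝ}
    (ha : 0 ≤ a) (hb : 0 ≤ b) (hx : 0 ≤ x) (hy : 0 ≤ y) (hab : a + b ≤ 1) :
    (a ^ (1 / p) * x + b ^ (1 / p) * y) ^ q ≤ x ^ q + y ^ q := by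
  have hp := hpq.pos
  have hq := hpq.symm.pos
  have holder := Real.inner_le_Lp_mul_Lq_of_nonneg (Finset.univ : Finset (Fin 2)) hpq
    (f := ![a ^ (1 / p), b ^ (1 / p)]) (g := ![x, y])
    (by intro i _; fin_cases i <;> simp <;> positivity)
    (by intro i _; fin_cases i <;> simpa)
  simp only [Fin.sum_univ_two, Matrix.cons_val_zero, Matrix.cons_val_one, one_div,
    Real.rpow_inv_rpow ha hp.ne', Real.rpow_inv_rpow hb hp.ne'] at holder
  have hle : a ^ (1 / p) * x + b ^ (1 / p) * y ≤ (x ^ q + y ^ q) ^ q⁻¹ := by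
    rw [one_div]
    exact holder.trans (mul_le_of_le_one_left (by positivity)
      (Real.rpow_le_one (by positivity) hab (by positivity)))
  calc (a ^ (1 / p) * x + b ^ (1 / p) * y) ^ q ≤ ((x ^ q + y ^ q) ^ q⁻¹) ^ q := by gcongr
    _ = x ^ q + y ^ q := Real.rpow_inv_rpow (by positivity) hq.ne'

/-- Fact (i) in the proof of the local Adams inequality: `inf_{t ≥ 0} F(t) ≥ −c`
with `c = c(p, b₂, b₃)` independent of `φ` and `ψ`. -/
theorem adamsF_bounded_below (p b₂ b₃ : ℝ) (hp : 1 < p) (hb₂ : 0 ≤ b₂) (hb₃ : 0 ≤ b₃) :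
    ∃ c : ℝ, 0 ≤ c ∧ ∀ φ ψ : ℝ → ℝ, Measurable φ → Measurable ψ →
      (∀ s, 0 ≤ φ s) → (∀ s, 0 ≤ ψ s) →
      (∫⁻ s, ENNReal.ofReal (φ s ^ p)) ≤ 1 →
      (∀ t : ℝ, 0 ≤ t →
        (∫⁻ s in Iic t, ENNReal.ofReal (ψ s ^ (p / (p - 1)))) ≤ ENNReal.ofReal (b₂ + t)) →
      (∀ t : ℝ, 0 ≤ t →
        ENNReal.ofReal (Real.exp (t / p)) *
          (∫⁻ s in Ioi t, ENNReal.ofReal (Real.exp (-s / p) * ψ s)) ≤ ENNReal.ofReal b₃) →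
      ∀ t : ℝ, 0 ≤ t → adamsF p φ ψ t ≥ -c := by
  have hpq : p.HolderConjugate (p / (p - 1)) := Real.HolderConjugate.conjExponent hp
  unfold adamsF
  generalize p / (p - 1) = q at hpq ⊢
  have hp₀ := hpq.pos
  have hq₀ := hpq.symm.pos
  refine ⟨b₃ ^ q + b₂, by positivity, fun φ ψ hφm hψm hφ hψ hφp hψq hψe t ht => ?_⟩
  have hsplit := lintegral_add_compl (μ := volume) (fun s => ENNReal.ofReal (φ s ^ p))
    (measurableSet_Ioi (a := t))
  rw [compl_Ioi] at hsplit
  rw [← hsplit] at hφp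
  have hA := ne_top_of_le_ne_top ENNReal.one_ne_top (le_self_add.trans hφp)
  have hB := ne_top_of_le_ne_top ENNReal.one_ne_top (le_add_self.trans hφp)
  set A := ∫⁻ s in Ioi t, ENNReal.ofReal (φ s ^ p)
  set B := ∫⁻ s in Iic t, ENNReal.ofReal (φ s ^ p)
  have hAB : A.toReal + B.toReal ≤ 1 := by
    rw [← ENNReal.toReal_add hA hB]
    exact ENNReal.toReal_mono ENNReal.one_ne_top hφp
  have hinner : ∫ s in Iic t, φ s * ψ s ≤ B.toReal ^ (1 / p) * (b₂ + t) ^ (1 / q) :=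
    integral_mul_le_of_lintegral_rpow_le hpq hφm hψm hφ hψ ENNReal.toReal_nonneg (by positivity)
      (ENNReal.ofReal_toReal hB).ge (hψq t ht)
  have htailφ : ∫ s in Ioi t, Real.exp (-s / q) * φ s ≤
      A.toReal ^ (1 / p) * Real.exp (-t) ^ (1 / q) := by
    simp_rw [mul_comm (Real.exp _) (φ _)]
    exact integral_mul_le_of_lintegral_rpow_le hpq hφm (by fun_prop) hφ
      (fun s => (Real.exp_pos _).le) ENNReal.toReal_nonneg (Real.exp_pos _).le
      (ENNReal.ofReal_toReal hA).ge (lintegral_exp_neg_div_rpow_Ioi hq₀.ne' t).le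
  have htailψ : Real.exp (t / p) * ∫ s in Ioi t, Real.exp (-s / p) * ψ s ≤ b₃ := by
    rw [integral_eq_lintegral_of_nonneg_ae
      (.of_forall fun s => mul_nonneg (Real.exp_pos _).le (hψ s))
      (by fun_prop), ← ENNReal.toReal_ofReal (Real.exp_pos (t / p)).le, ← ENNReal.toReal_mul]
    exact ENNReal.toReal_le_of_le_ofReal hb₃ (hψe t ht)
  have hφ_nonneg : 0 ≤ ∫ s in Ioi t, Real.exp (-s / q) * φ s :=
    integral_nonneg fun s => mul_nonneg (Real.exp_pos _).le (hφ s)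
  have hψ_nonneg : 0 ≤ ∫ s in Ioi t, Real.exp (-s / p) * ψ s :=
    integral_nonneg fun s => mul_nonneg (Real.exp_pos _).le (hψ s)
  have hφψ_nonneg : 0 ≤ ∫ s in Iic t, φ s * ψ s :=
    integral_nonneg fun s => mul_nonneg (hφ s) (hψ s)
  have hexp : Real.exp t * Real.exp (-t) ^ (1 / q) = Real.exp (t / p) := by
    rw [← Real.exp_mul, ← Real.exp_add]
    congr 1
    linear_combination (-t) * hpq.inv_add_inv_eq_one
  have houter : Real.exp t * (∫ s in Ioi t, Real.exp (-s / q) * φ s) *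
      (∫ s in Ioi t, Real.exp (-s / p) * ψ s) ≤ A.toReal ^ (1 / p) * b₃ := by
    calc _ ≤ Real.exp t * (A.toReal ^ (1 / p) * Real.exp (-t) ^ (1 / q)) *
          (∫ s in Ioi t, Real.exp (-s / p) * ψ s) := by gcongr
      _ = A.toReal ^ (1 / p) *
          (Real.exp (t / p) * ∫ s in Ioi t, Real.exp (-s / p) * ψ s) := by
        rw [← hexp]; ring
      _ ≤ A.toReal ^ (1 / p) * b₃ := by gcongr
  have hpow := (Real.rpow_le_rpow (by positivity) (add_le_add houter hinner) hq₀.le).trans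
    (rpow_mul_add_rpow_mul_rpow_le hpq ENNReal.toReal_nonneg ENNReal.toReal_nonneg hb₃
      (by positivity) hAB)
  rw [one_div q, Real.rpow_inv_rpow (by positivity) hq₀.ne'] at hpow
  linarith
end

section
/- Let p ∈ (1,∞), p' = p/(p−1), and let β > 0, T > 0, K ≥ 0, ε > 0, b₁ ≥ 0. Then there exists a constant C > 0, depending only on p, β, T, K, ε, b₁, with the following property: for all Lebesgue-measurable functions g, h : (0,∞) → [0,∞) such that (a) ∫_0^∞ g(s)^p ds ≤ 1, (b) β^{1/p'} t^{1/p'} h(t) ≤ 1 + K t^{ε} for every t ∈ (0, T], and (c) ∫_T^∞ h(t)^{p'} dt ≤ b₁, one has (1/T) ∫_0^T exp( β [ (1/t) ∫_0^t g(s) ds · ∫_0^t h(s) ds + ∫_t^∞ g(s) h(s) ds ]^{p'} ) dt ≤ C. -/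
open MeasureTheory Set

theorem young_add_sq_sqrt_sub_le {a b α γ : ℝ} (ha : 0 ≤ a) (hb : 0 ≤ b) (hα : 0 ≤ α)
    (hγ : 0 ≤ γ) (hαγ : α + γ = 1) :
    a ^ α * b ^ γ + min α γ * (√a - √b) ^ 2 ≤ α * a + γ * b := by
  set κ := min α γ with hκ
  have hκα : κ ≤ α := min_le_left _ _
  have hκγ : κ ≤ γ := min_le_right _ _
  have hκ0 : 0 ≤ κ := le_min hα hγ
  have key := Real.geom_mean_le_arith_mean3_weighted (sub_nonneg.2 hκα) (sub_nonneg.2 hκγ)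
    (by positivity : 0 ≤ 2 * κ) ha hb (by positivity : 0 ≤ √a * √b) (by linarith)
  have hs : (√a * √b) ^ (2 * κ) = a ^ κ * b ^ κ := by
    rw [Real.rpow_mul (by positivity), Real.rpow_two, mul_pow, Real.sq_sqrt ha, Real.sq_sqrt hb,
      Real.mul_rpow ha hb]
  have hmul : ∀ {x r : ℝ}, 0 ≤ x → κ ≤ r → x ^ (r - κ) * x ^ κ = x ^ r := fun hx hr => by
    rw [← Real.rpow_add_of_nonneg hx (sub_nonneg.2 hr) hκ0, sub_add_cancel]
  rw [hs] at key
  have h1 : a ^ (α - κ) * b ^ (γ - κ) * (a ^ κ * b ^ κ) = a ^ α * b ^ γ := by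
    rw [← hmul ha hκα, ← hmul hb hκγ]; ring
  rw [h1] at key
  nlinarith [Real.sq_sqrt ha, Real.sq_sqrt hb]

theorem rpow_add_sq_sqrt_sub_le {p q X D l u : ℝ} (hpq : p.HolderConjugate q) (hX : 0 < X)
    (hD : 0 < D) (hl0 : 0 ≤ l) (hl1 : l ≤ 1) (hu : 0 ≤ u)
    (h : u ≤ X ^ q⁻¹ * (1 - l) ^ p⁻¹ + D ^ q⁻¹ * l ^ p⁻¹) :
    u ^ q + min q⁻¹ p⁻¹ * (√D - √((X + D) * l)) ^ 2 ≤ X + D := by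
  set S := X + D with hS
  have hS0 : 0 < S := by positivity
  set κ := min q⁻¹ p⁻¹ with hκ
  have hκ0 : 0 ≤ κ := le_min hpq.symm.inv_nonneg hpq.inv_nonneg
  have hq : 1 ≤ q := hpq.symm.lt.le
  have hadd : q⁻¹ + p⁻¹ = 1 := hpq.symm.inv_add_inv_eq_one
  have e1 := young_add_sq_sqrt_sub_le (a := X / S) (b := 1 - l) (by positivity) (by linarith)
    hpq.symm.inv_nonneg hpq.inv_nonneg hadd
  have e2 := young_add_sq_sqrt_sub_le (a := D / S) (b := l) (by positivity) hl0
    hpq.symm.inv_nonneg hpq.inv_nonneg hadd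
  have hXD : X / S + D / S = 1 := by rw [← add_div]; exact div_self hS0.ne'
  set m := 1 - κ * (√(D / S) - √l) ^ 2 with hm
  have hum : u / S ^ q⁻¹ ≤ m := by
    rw [div_le_iff₀ (by positivity)]
    refine h.trans ?_
    rw [Real.div_rpow hX.le hS0.le] at e1
    rw [Real.div_rpow hD.le hS0.le] at e2
    have : (X ^ q⁻¹ * (1 - l) ^ p⁻¹ + D ^ q⁻¹ * l ^ p⁻¹) =
      (X ^ q⁻¹ / S ^ q⁻¹ * (1 - l) ^ p⁻¹ + D ^ q⁻¹ / S ^ q⁻¹ * l ^ p⁻¹) * S ^ q⁻¹ := by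
      field_simp
    rw [this]
    gcongr
    have : 0 ≤ κ * (√(X / S) - √(1 - l)) ^ 2 := by positivity
    have : q⁻¹ * (X / S) + p⁻¹ * (1 - l) + (q⁻¹ * (D / S) + p⁻¹ * l) = 1 := by
      linear_combination q⁻¹ * hXD + hadd
    linarith
  have hm0 : 0 ≤ m := le_trans (by positivity) hum
  have hm1 : m ≤ 1 := by
    have : 0 ≤ κ * (√(D / S) - √l) ^ 2 := by positivity
    linarith
  have huq : u ^ q ≤ S * m := by
    have h1 : (u / S ^ q⁻¹) ^ q ≤ m ^ q := Real.rpow_le_rpow (by positivity) hum (by linarith)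
    rw [Real.div_rpow hu (by positivity), Real.rpow_inv_rpow hS0.le (by linarith),
      div_le_iff₀ hS0] at h1
    have h2 : m ^ q ≤ m := Real.rpow_le_self_of_le_one hm0 hm1 hq
    nlinarith
  have hsq : (√D - √(S * l)) ^ 2 = S * (√(D / S) - √l) ^ 2 := by
    have hDS : √D = √S * √(D / S) := by
      rw [← Real.sqrt_mul hS0.le, mul_div_cancel₀ _ hS0.ne']
    rw [Real.sqrt_mul hS0.le, hDS, ← mul_sub, mul_pow, Real.sq_sqrt hS0.le]
  rw [hsq]
  rw [hm] at huq
  linarith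

theorem le_two_mul_of_sq_sqrt_sub_le {a b x y : ℝ} (hx : 0 ≤ x) (hy : 0 ≤ y)
    (ha : 0 < a) (h : a * (√x - √y) ^ 2 ≤ b) : x ≤ 2 * y + 2 * (b / a) := by
  have h' : (√x - √y) ^ 2 ≤ b / a := by rw [le_div_iff₀ ha]; linarith
  nlinarith [Real.sq_sqrt hx, Real.sq_sqrt hy, sq_nonneg (√x - 2 * √y)]

theorem le_of_two_point_deficit {p q X d c l u₁ u₂ μ : ℝ} (hpq : p.HolderConjugate q)
    (hX : 0 < X) (hd : 0 ≤ d) (hc : 0 < c) (hl0 : 0 ≤ l) (hl1 : l ≤ 1) (hu₁ : 0 ≤ u₁)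
    (hu₂ : 0 ≤ u₂) (h₁ : u₁ ≤ X ^ q⁻¹ * (1 - l) ^ p⁻¹ + c ^ q⁻¹ * l ^ p⁻¹)
    (h₂ : u₂ ≤ X ^ q⁻¹ * (1 - l) ^ p⁻¹ + (d + c) ^ q⁻¹ * l ^ p⁻¹)
    (hμ₁ : X + c - u₁ ^ q ≤ μ) (hμ₂ : X + (d + c) - u₂ ^ q ≤ μ)
    (hN : 2 * (4 * c + 6 * (μ / min q⁻¹ p⁻¹)) ≤ X) :
    d ≤ 2 * (4 * c + 6 * (μ / min q⁻¹ p⁻¹)) := by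
  have hκ0 : 0 < min q⁻¹ p⁻¹ := lt_min hpq.symm.inv_pos hpq.inv_pos
  have e1 := rpow_add_sq_sqrt_sub_le hpq hX hc hl0 hl1 hu₁ h₁
  have e2 := rpow_add_sq_sqrt_sub_le hpq hX (by positivity) hl0 hl1 hu₂ h₂
  set κ := min q⁻¹ p⁻¹
  have hμ : 0 ≤ μ := by
    have : 0 ≤ κ * (√c - √((X + c) * l)) ^ 2 := by positivity
    linarith
  have f1 := le_two_mul_of_sq_sqrt_sub_le (x := (X + c) * l) (y := c) (b := μ) (by positivity)
    hc.le hκ0 (by rw [← neg_sub, neg_sq]; linarith)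
  have f2 := le_two_mul_of_sq_sqrt_sub_le (x := d + c) (y := (X + (d + c)) * l) (b := μ)
    (by positivity) (by positivity) hκ0 (by linarith)
  set ν := μ / κ
  have hν : 0 ≤ ν := by positivity
  have g1 : X * l ≤ 2 * c + 2 * ν := by nlinarith
  have g2 : X * (d + c) ≤ (X + (d + c)) * (4 * c + 6 * ν) := by
    have := mul_le_mul_of_nonneg_left f2 hX.le
    have := mul_le_mul_of_nonneg_left g1 (by positivity : 0 ≤ 2 * (X + (d + c)))
    nlinarith [mul_nonneg hν (by positivity : 0 ≤ d + c)]
  have g3 : X * (d + c) ≤ X * (2 * (4 * c + 6 * ν)) := by nlinarith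
  linarith [le_of_mul_le_mul_left g3 hX]

theorem lintegral_inv_Ioc {a b : ℝ} (ha : 0 < a) (hab : a ≤ b) :
    ∫⁻ t in Ioc a b, ENNReal.ofReal t⁻¹ = ENNReal.ofReal (Real.log (b / a)) := by
  have hi : IntervalIntegrable (fun x : ℝ => x⁻¹) volume a b :=
    intervalIntegrable_inv_iff.2 (Or.inr (notMem_uIcc_of_lt ha (ha.trans_le hab)))
  rw [← ofReal_integral_eq_lintegral_ofReal, ← intervalIntegral.integral_of_le hab,
    integral_inv_of_pos ha (ha.trans_le hab)]
  · exact (intervalIntegrable_iff_integrableOn_Ioc_of_le hab).1 hi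
  · filter_upwards [ae_restrict_mem measurableSet_Ioc] with x hx
    exact inv_nonneg.2 (ha.trans hx.1).le

theorem exists_measurable_cover_of_log_dist_le {T N : ℝ} (hT : 0 < T) (hN : 0 ≤ N) {E : Set ℝ}
    (hE : E ⊆ Ioc 0 T)
    (h : ∀ t ∈ E, ∀ r ∈ E, t ≤ r → N ≤ Real.log (T / r) → Real.log (r / t) ≤ N) :
    ∃ A : Set ℝ, MeasurableSet A ∧ E ⊆ A ∧
      ∫⁻ t in A, ENNReal.ofReal t⁻¹ ≤ ENNReal.ofReal (3 * N) := by
  have hlen : ∀ {x m : ℝ}, 0 < x → 0 ≤ m →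
      ∫⁻ t in Icc (x * Real.exp (-N)) (x * Real.exp m), ENNReal.ofReal t⁻¹ ≤
        ENNReal.ofReal (N + m) := fun {x m} hx hm => by
    rw [setLIntegral_congr Ioc_ae_eq_Icc.symm, lintegral_inv_Ioc (by positivity) (by gcongr; linarith),
      mul_div_mul_left _ _ hx.ne', ← Real.exp_sub, Real.log_exp]
    exact ENNReal.ofReal_le_ofReal (by linarith)
  have hnear : ∀ t ∈ E, ¬ N ≤ Real.log (T / t) →
      t ∈ Icc (T * Real.exp (-N)) (T * Real.exp 0) := fun t ht hlog => by
    have ht0 := (hE ht).1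
    refine ⟨?_, by simpa using (hE ht).2⟩
    rw [not_le, Real.log_lt_iff_lt_exp (by positivity), div_lt_iff₀ ht0] at hlog
    rw [Real.exp_neg, ← div_eq_mul_inv, div_le_iff₀ (by positivity)]
    linarith
  by_cases hfar : ∃ x ∈ E, N ≤ Real.log (T / x)
  · obtain ⟨x, hxE, hx⟩ := hfar
    have hx0 := (hE hxE).1
    refine ⟨Icc (T * Real.exp (-N)) (T * Real.exp 0) ∪
      Icc (x * Real.exp (-N)) (x * Real.exp N), measurableSet_Icc.union measurableSet_Icc,
      fun t ht => ?_, ?_⟩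
    · by_cases htN : N ≤ Real.log (T / t)
      · have ht0 := (hE ht).1
        refine Or.inr ?_
        rw [mem_Icc, Real.exp_neg, ← div_eq_mul_inv, div_le_iff₀ (by positivity)]
        rcases le_total t x with htx | htx
        · have := h t ht x hxE htx hx
          rw [Real.log_le_iff_le_exp (by positivity), div_le_iff₀ ht0] at this
          exact ⟨by linarith, htx.trans (le_mul_of_one_le_right hx0.le (Real.one_le_exp hN))⟩
        · have := h x hxE t ht htx htN
          rw [Real.log_le_iff_le_exp (by positivity), div_le_iff₀ hx0] at this
          exact ⟨htx.trans (le_mul_of_one_le_right ht0.le (Real.one_le_exp hN)), by linarith⟩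
      · exact Or.inl (hnear t ht htN)
    · refine (lintegral_union_le _ _ _).trans ((add_le_add (hlen hT le_rfl) (hlen hx0 hN)).trans ?_)
      rw [← ENNReal.ofReal_add (by linarith) (by linarith)]
      exact ENNReal.ofReal_le_ofReal (by linarith)
  · push Not at hfar
    refine ⟨Icc (T * Real.exp (-N)) (T * Real.exp 0), measurableSet_Icc,
      fun t ht => hnear t ht (hfar t ht).not_ge, (hlen hT le_rfl).trans ?_⟩
    exact ENNReal.ofReal_le_ofReal (by linarith)

theorem exists_lintegral_exp_rpow_le {p q c T : ℝ} (hpq : p.HolderConjugate q) (hc : 0 < c)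
    (hT : 0 < T) :
    ∃ C : ℝ, 0 < C ∧ ∀ u l : ℝ → ℝ, (∀ t, 0 ≤ u t) → (∀ r, 0 ≤ l r) → (∀ r, l r ≤ 1) →
      (∀ t r : ℝ, 0 < t → t ≤ r → r ≤ T →
        u t ≤ (Real.log (T / r) + c) ^ q⁻¹ * (1 - l r) ^ p⁻¹ +
          (Real.log (r / t) + c) ^ q⁻¹ * l r ^ p⁻¹) →
      ∫⁻ t in Ioc 0 T, ENNReal.ofReal (Real.exp (u t ^ q)) ≤ ENNReal.ofReal (C * T) := by
  set κ := min q⁻¹ p⁻¹ with hκ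
  have hκ0 : 0 < κ := lt_min hpq.symm.inv_pos hpq.inv_pos
  set N : ℕ → ℝ := fun n => 2 * (4 * c + 6 * ((n + 1) / κ)) with hNdef
  have hN : ∀ n, 0 ≤ N n := fun n => by positivity
  have hsum : Summable fun n : ℕ => Real.exp (-n) * (3 * N n) := by
    have h0 := Real.summable_pow_mul_exp_neg_nat_mul 0 (r := 1) one_pos
    have h1 := Real.summable_pow_mul_exp_neg_nat_mul 1 (r := 1) one_pos
    refine ((h0.mul_left (24 * c + 36 / κ)).add (h1.mul_left (36 / κ))).congr fun n => ?_
    simp only [hNdef, neg_one_mul, pow_zero, pow_one]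
    ring
  refine ⟨Real.exp (2 * c) * ∑' n : ℕ, Real.exp (-n) * (3 * N n), ?_, ?_⟩
  · refine mul_pos (Real.exp_pos _) (hsum.tsum_pos (fun n => by positivity) 0 ?_)
    positivity
  intro u l hu hl0 hl1 H
  set F : ℝ → ℝ := fun t => Real.log (T / t) + 2 * c - u t ^ q with hF
  have hlog : ∀ {x y : ℝ}, 0 < x → x ≤ y → 0 ≤ Real.log (y / x) := fun hx hxy =>
    Real.log_nonneg ((one_le_div hx).2 hxy)
  have hlogadd : ∀ {t r : ℝ}, 0 < t → 0 < r →
      Real.log (T / t) = Real.log (T / r) + Real.log (r / t) := fun ht hr => by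
    rw [← Real.log_mul (by positivity) (by positivity)]
    congr 1
    field_simp
  have hdiag : ∀ t, 0 < t → t ≤ T →
      u t ≤ (Real.log (T / t) + c) ^ q⁻¹ * (1 - l t) ^ p⁻¹ + c ^ q⁻¹ * l t ^ p⁻¹ :=
    fun t ht htT => by simpa [div_self ht.ne'] using H t t ht le_rfl htT
  have hF0 : ∀ t ∈ Ioc 0 T, 0 ≤ F t := fun t ⟨ht, htT⟩ => by
    have hX := hlog ht htT
    have e := rpow_add_sq_sqrt_sub_le hpq (by positivity) hc (hl0 t) (hl1 t) (hu t)
      (hdiag t ht htT)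
    have : 0 ≤ κ * (√c - √((Real.log (T / t) + c + c) * l t)) ^ 2 := by positivity
    simp only [hF]
    linarith
  have hcover : ∀ n : ℕ, ∃ A : Set ℝ, MeasurableSet A ∧ {t ∈ Ioc 0 T | F t ≤ n + 1} ⊆ A ∧
      ∫⁻ t in A, ENNReal.ofReal t⁻¹ ≤ ENNReal.ofReal (3 * N n) := fun n => by
    refine exists_measurable_cover_of_log_dist_le hT (hN n) (sep_subset _ _) ?_
    rintro t ⟨⟨ht0, htT⟩, hFt⟩ r ⟨⟨hr0, hrT⟩, hFr⟩ htr hNr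
    have hX := hlog hr0 hrT
    simp only [hF] at hFt hFr
    refine le_of_two_point_deficit hpq (X := Real.log (T / r) + c) (by positivity) (hlog ht0 htr)
      hc (hl0 r) (hl1 r) (hu r) (hu t) (hdiag r hr0 hrT) (H t r ht0 htr hrT) (μ := n + 1)
      (by linarith) ?_ (hNr.trans (by linarith))
    rw [hlogadd ht0 hr0] at hFt
    linarith
  choose A hAm hEA hA using hcover
  have hpt : ∀ t ∈ Ioc 0 T, ENNReal.ofReal (Real.exp (u t ^ q)) ≤
      ∑' n : ℕ, ENNReal.ofReal (T * Real.exp (2 * c) * Real.exp (-n)) *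
        (A n).indicator (fun s => ENNReal.ofReal s⁻¹) t := fun t ht => by
    have hfl := Nat.floor_le (hF0 t ht)
    have hmem : t ∈ A ⌊F t⌋₊ := hEA _ ⟨ht, (Nat.lt_floor_add_one _).le⟩
    refine le_trans ?_ (ENNReal.le_tsum ⌊F t⌋₊)
    rw [indicator_of_mem hmem, ← ENNReal.ofReal_mul (by positivity)]
    refine ENNReal.ofReal_le_ofReal ?_
    have h1 : u t ^ q = Real.log (T / t) + (2 * c + -F t) := by simp only [hF]; ring
    have ht0 := ht.1
    rw [h1, Real.exp_add, Real.exp_add, Real.exp_log (by positivity)]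
    have h2 : Real.exp (-F t) ≤ Real.exp (-⌊F t⌋₊) := Real.exp_le_exp.2 (by linarith)
    calc T / t * (Real.exp (2 * c) * Real.exp (-F t))
        ≤ T / t * (Real.exp (2 * c) * Real.exp (-⌊F t⌋₊)) := by gcongr
      _ = T * Real.exp (2 * c) * Real.exp (-⌊F t⌋₊) * t⁻¹ := by ring
  have hmeas : ∀ n, Measurable ((A n).indicator fun s : ℝ => ENNReal.ofReal s⁻¹) := fun n =>
    (measurable_inv.ennreal_ofReal).indicator (hAm n)
  calc ∫⁻ t in Ioc 0 T, ENNReal.ofReal (Real.exp (u t ^ q))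
      ≤ ∫⁻ t in Ioc 0 T, ∑' n : ℕ, ENNReal.ofReal (T * Real.exp (2 * c) * Real.exp (-n)) *
        (A n).indicator (fun s => ENNReal.ofReal s⁻¹) t := setLIntegral_mono' measurableSet_Ioc hpt
    _ ≤ ∫⁻ t, ∑' n : ℕ, ENNReal.ofReal (T * Real.exp (2 * c) * Real.exp (-n)) *
        (A n).indicator (fun s => ENNReal.ofReal s⁻¹) t := setLIntegral_le_lintegral _ _
    _ = ∑' n : ℕ, ENNReal.ofReal (T * Real.exp (2 * c) * Real.exp (-n)) *
        ∫⁻ t in A n, ENNReal.ofReal t⁻¹ := by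
      rw [lintegral_tsum fun n => ((hmeas n).const_mul _).aemeasurable]
      refine tsum_congr fun n => ?_
      rw [lintegral_const_mul _ (hmeas n), lintegral_indicator (hAm n)]
    _ ≤ ∑' n : ℕ, ENNReal.ofReal (T * Real.exp (2 * c) * (Real.exp (-n) * (3 * N n))) := by
      refine ENNReal.tsum_le_tsum fun n => (mul_le_mul_right (hA n) _).trans_eq ?_
      rw [← ENNReal.ofReal_mul (by positivity), mul_assoc _ (Real.exp (-n))]
    _ = ENNReal.ofReal (Real.exp (2 * c) * (∑' n : ℕ, Real.exp (-n) * (3 * N n)) * T) := by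
      rw [← ENNReal.ofReal_tsum_of_nonneg (fun n => by have := hN n; positivity)
        (hsum.mul_left _), tsum_mul_left]
      congr 1
      ring

theorem ofReal_integral_le_lintegral_ofReal {α : Type*} [MeasurableSpace α] {μ : Measure α}
    {f : α → ℝ} (hf : ∀ x, 0 ≤ f x) :
    ENNReal.ofReal (∫ x, f x ∂μ) ≤ ∫⁻ x, ENNReal.ofReal (f x) ∂μ := by
  by_cases hi : Integrable f μ
  · exact (ofReal_integral_eq_lintegral_ofReal hi (Filter.Eventually.of_forall hf)).le
  · simp [integral_undef hi]

theorem lintegral_ofReal_mul_le_of_holder {α : Type*} [MeasurableSpace α] {μ : Measure α}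
    {p q X L : ℝ} (hpq : p.HolderConjugate q) {w g : α → ℝ} (hw : Measurable w)
    (hg : Measurable g) (hw0 : ∀ x, 0 ≤ w x) (hg0 : ∀ x, 0 ≤ g x) (hX : 0 ≤ X) (hL : 0 ≤ L)
    (hwX : ∫⁻ x, ENNReal.ofReal (w x ^ q) ∂μ ≤ ENNReal.ofReal X)
    (hgL : ∫⁻ x, ENNReal.ofReal (g x ^ p) ∂μ ≤ ENNReal.ofReal L) :
    ∫⁻ x, ENNReal.ofReal (w x * g x) ∂μ ≤ ENNReal.ofReal (X ^ q⁻¹ * L ^ p⁻¹) := by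
  have h := ENNReal.lintegral_mul_le_Lp_mul_Lq μ hpq.symm hw.ennreal_ofReal.aemeasurable
    hg.ennreal_ofReal.aemeasurable
  simp only [Pi.mul_apply, ENNReal.ofReal_rpow_of_nonneg (hw0 _) hpq.symm.nonneg,
    ENNReal.ofReal_rpow_of_nonneg (hg0 _) hpq.nonneg, one_div] at h
  rw [ENNReal.ofReal_mul (by positivity), ← ENNReal.ofReal_rpow_of_nonneg hX hpq.symm.inv_nonneg,
    ← ENNReal.ofReal_rpow_of_nonneg hL hpq.inv_nonneg]
  simp only [ENNReal.ofReal_mul (hw0 _)]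
  refine h.trans ?_
  have := hpq.inv_nonneg
  have := hpq.symm.inv_nonneg
  gcongr

theorem one_add_mul_rpow_le {q K Z z : ℝ} (hq : 1 ≤ q) (hK : 0 ≤ K) (hZ : 0 < Z) (hz : 0 ≤ z)
    (hzZ : z ≤ Z) : (1 + K * z) ^ q ≤ 1 + ((1 + K * Z) ^ q - 1) / Z * z := by
  have hzZ' : z / Z ≤ 1 := (div_le_one hZ).2 hzZ
  have h := (convexOn_rpow hq).2 (mem_Ici.2 zero_le_one)
    (mem_Ici.2 (by positivity : 0 ≤ 1 + K * Z)) (sub_nonneg.2 hzZ')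
    (by positivity : 0 ≤ z / Z) (sub_add_cancel _ _)
  simp only [smul_eq_mul, Real.one_rpow, mul_one] at h
  have e1 : 1 - z / Z + z / Z * (1 + K * Z) = 1 + K * z := by field_simp; ring
  rw [e1] at h
  refine h.trans_eq ?_
  ring

theorem lintegral_rpow_Ioc_le {q K T ε a b : ℝ} {k : ℝ → ℝ} (hq : 1 ≤ q) (hK : 0 ≤ K)
    (hε : 0 < ε) (ha : 0 < a) (hab : a ≤ b) (hbT : b ≤ T) (hk0 : ∀ s, 0 ≤ k s)
    (hk : ∀ s, 0 < s → s ≤ T → k s ≤ (1 + K * s ^ ε) * s ^ (-q⁻¹)) :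
    ∫⁻ s in Ioc a b, ENNReal.ofReal (k s ^ q) ≤
      ENNReal.ofReal (Real.log (b / a) + ((1 + K * T ^ ε) ^ q - 1) / ε) := by
  have hT : 0 < T := by linarith
  have hTε : 0 < T ^ ε := by positivity
  set M := ((1 + K * T ^ ε) ^ q - 1) / T ^ ε with hM
  have hM0 : 0 ≤ M := by
    refine div_nonneg (sub_nonneg.2 (Real.one_le_rpow ?_ (by linarith))) hTε.le
    have : 0 ≤ K * T ^ ε := by positivity
    linarith
  have hlog : 0 ≤ Real.log (b / a) := Real.log_nonneg ((one_le_div ha).2 hab)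
  have hpt : ∀ s ∈ Ioc a b, ENNReal.ofReal (k s ^ q) ≤
      ENNReal.ofReal s⁻¹ + ENNReal.ofReal (M * s ^ (ε - 1)) := fun s hs => by
    have hs0 : 0 < s := ha.trans hs.1
    have hsT : s ≤ T := hs.2.trans hbT
    rw [← ENNReal.ofReal_add (by positivity) (by positivity)]
    refine ENNReal.ofReal_le_ofReal ?_
    calc k s ^ q ≤ ((1 + K * s ^ ε) * s ^ (-q⁻¹)) ^ q :=
          Real.rpow_le_rpow (hk0 s) (hk s hs0 hsT) (by linarith)
      _ = (1 + K * s ^ ε) ^ q * s⁻¹ := by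
          rw [Real.mul_rpow (by positivity) (by positivity), ← Real.rpow_mul hs0.le,
            neg_mul, inv_mul_cancel₀ (by linarith), Real.rpow_neg_one]
      _ ≤ (1 + M * s ^ ε) * s⁻¹ := by
          gcongr
          exact one_add_mul_rpow_le hq hK hTε (by positivity)
            (Real.rpow_le_rpow hs0.le hsT hε.le)
      _ = s⁻¹ + M * s ^ (ε - 1) := by rw [Real.rpow_sub_one hs0.ne']; ring
  refine (setLIntegral_mono' measurableSet_Ioc hpt).trans ?_
  rw [lintegral_add_left (by fun_prop), lintegral_inv_Ioc ha hab, ENNReal.ofReal_add hlog (by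
    rw [← div_mul_cancel₀ ((1 + K * T ^ ε) ^ q - 1) hTε.ne']; positivity)]
  gcongr
  have hi : IntervalIntegrable (fun s : ℝ => s ^ (ε - 1)) volume a b :=
    intervalIntegral.intervalIntegrable_rpow' (by linarith)
  rw [← ofReal_integral_eq_lintegral_ofReal, integral_const_mul,
    ← intervalIntegral.integral_of_le hab, integral_rpow (Or.inl (by linarith))]
  · refine ENNReal.ofReal_le_ofReal ?_
    have h1 : b ^ (ε - 1 + 1) - a ^ (ε - 1 + 1) ≤ T ^ ε := by
      rw [sub_add_cancel]
      have := Real.rpow_le_rpow (by linarith) hbT hε.le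
      have : 0 ≤ a ^ ε := by positivity
      linarith
    calc M * ((b ^ (ε - 1 + 1) - a ^ (ε - 1 + 1)) / (ε - 1 + 1)) ≤ M * (T ^ ε / ε) := by
          rw [sub_add_cancel] at h1 ⊢; gcongr
      _ = ((1 + K * T ^ ε) ^ q - 1) / ε := by rw [hM]; field_simp
  · exact ((intervalIntegrable_iff_integrableOn_Ioc_of_le hab).1 hi).const_mul M
  · filter_upwards [ae_restrict_mem measurableSet_Ioc] with s hs
    have hs0 : 0 < s := ha.trans hs.1
    simp only [Pi.zero_apply]
    positivity

theorem average_Ioc_le {p q K T ε t : ℝ} {k : ℝ → ℝ} (hpq : p.HolderConjugate q) (hK : 0 ≤ K)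
    (hε : 0 < ε) (ht : 0 < t) (htT : t ≤ T) (hk0 : ∀ s, 0 ≤ k s)
    (hk : ∀ s, 0 < s → s ≤ T → k s ≤ (1 + K * s ^ ε) * s ^ (-q⁻¹)) :
    1 / t * ∫ s in Ioc 0 t, k s ≤ (1 + K * T ^ ε) * p * t ^ (-q⁻¹) := by
  have hp0 := hpq.pos
  have hexp : -q⁻¹ + 1 = p⁻¹ := by linarith [hpq.inv_add_inv_eq_one]
  have hgt : -1 < -q⁻¹ := by linarith [hpq.inv_pos]
  have hi : IntervalIntegrable (fun s : ℝ => s ^ (-q⁻¹)) volume 0 t :=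
    intervalIntegral.intervalIntegrable_rpow' hgt
  have hle : ∫ s in Ioc 0 t, k s ≤ ∫ s in Ioc 0 t, (1 + K * T ^ ε) * s ^ (-q⁻¹) := by
    refine integral_mono_of_nonneg (Filter.Eventually.of_forall hk0)
      (((intervalIntegrable_iff_integrableOn_Ioc_of_le ht.le).1 hi).const_mul _) ?_
    filter_upwards [ae_restrict_mem measurableSet_Ioc] with s hs
    have hs0 := hs.1
    have hsT := hs.2.trans htT
    refine (hk s hs0 hsT).trans ?_
    have := Real.rpow_le_rpow hs0.le hsT hε.le
    gcongr
  rw [integral_const_mul, ← intervalIntegral.integral_of_le (f := fun s : ℝ => s ^ (-q⁻¹)) ht.le,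
    integral_rpow (Or.inl hgt), hexp, Real.zero_rpow hpq.inv_pos.ne', sub_zero, div_inv_eq_mul] at hle
  calc 1 / t * ∫ s in Ioc 0 t, k s ≤ 1 / t * ((1 + K * T ^ ε) * (t ^ p⁻¹ * p)) := by gcongr
    _ = (1 + K * T ^ ε) * p * t ^ (-q⁻¹) := by
      rw [← hexp, Real.rpow_add_one ht.ne']
      field_simp

theorem oneil_bound_le {p q K T ε b t r : ℝ} {g k : ℝ → ℝ} (hpq : p.HolderConjugate q)
    (hK : 0 ≤ K) (hε : 0 < ε) (hb : 0 ≤ b) (ht : 0 < t) (htr : t ≤ r) (hrT : r ≤ T)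
    (hg : Measurable g) (hkm : Measurable k) (hg0 : ∀ s, 0 ≤ g s) (hk0 : ∀ s, 0 ≤ k s)
    (hgp : ∫⁻ s in Ioi (0 : ℝ), ENNReal.ofReal (g s ^ p) ≤ 1)
    (hk : ∀ s, 0 < s → s ≤ T → k s ≤ (1 + K * s ^ ε) * s ^ (-q⁻¹))
    (hkT : ∫⁻ s in Ioi T, ENNReal.ofReal (k s ^ q) ≤ ENNReal.ofReal b) {c : ℝ}
    (hc : c = ((1 + K * T ^ ε) * p) ^ q + ((1 + K * T ^ ε) ^ q - 1) / ε + b) :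
    1 / t * (∫ s in Ioc 0 t, g s) * (∫ s in Ioc 0 t, k s) + ∫ s in Ioi t, g s * k s ≤
      (Real.log (T / r) + c) ^ q⁻¹ *
          (1 - (∫⁻ s in Ioc 0 r, ENNReal.ofReal (g s ^ p)).toReal) ^ p⁻¹ +
        (Real.log (r / t) + c) ^ q⁻¹ *
          (∫⁻ s in Ioc 0 r, ENNReal.ofReal (g s ^ p)).toReal ^ p⁻¹ := by
  have hr : 0 < r := ht.trans_le htr
  have hT : 0 < T := hr.trans_le hrT
  have hq : 1 ≤ q := hpq.symm.lt.le
  have hp0 := hpq.pos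
  set m := ((1 + K * T ^ ε) ^ q - 1) / ε with hm
  have hm0 : 0 ≤ m := by
    refine div_nonneg (sub_nonneg.2 (Real.one_le_rpow ?_ (by linarith))) hε.le
    have : 0 ≤ K * T ^ ε := by positivity
    linarith
  set a := (1 + K * T ^ ε) * p with ha
  have ha0 : 0 ≤ a := by positivity
  have hc0 : 0 ≤ c := by rw [hc]; positivity
  have hX : 0 ≤ Real.log (T / r) := Real.log_nonneg ((one_le_div hr).2 hrT)
  have hD : 0 ≤ Real.log (r / t) := Real.log_nonneg ((one_le_div ht).2 htr)
  set I := ∫⁻ s in Ioc 0 r, ENNReal.ofReal (g s ^ p) with hI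
  have hsplit : I + ∫⁻ s in Ioi r, ENNReal.ofReal (g s ^ p) ≤ 1 := by
    rw [hI, ← lintegral_union measurableSet_Ioi (Ioc_disjoint_Ioi le_rfl),
      Ioc_union_Ioi_eq_Ioi hr.le]
    exact hgp
  have hI1 : I ≤ 1 := le_self_add.trans hsplit
  have hItop : I ≠ ⊤ := ne_top_of_le_ne_top ENNReal.one_ne_top hI1
  have hIr : I.toReal ≤ 1 := by simpa using ENNReal.toReal_mono ENNReal.one_ne_top hI1
  have hIrest : ∫⁻ s in Ioi r, ENNReal.ofReal (g s ^ p) ≤ ENNReal.ofReal (1 - I.toReal) := by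
    rw [ENNReal.ofReal_sub _ ENNReal.toReal_nonneg, ENNReal.ofReal_toReal hItop,
      ENNReal.ofReal_one]
    exact ENNReal.le_sub_of_add_le_left hItop hsplit
  set w : ℝ → ℝ := fun s => if s ≤ t then a * t ^ (-q⁻¹) else k s with hw
  have hwm : Measurable w := Measurable.ite measurableSet_Iic measurable_const hkm
  have hw0 : ∀ s, 0 ≤ w s := fun s => by
    simp only [hw]; split_ifs; exacts [by positivity, hk0 s]
  have hwt : ∀ s, s ≤ t → w s = a * t ^ (-q⁻¹) := fun s hs => if_pos hs
  have hwk : ∀ s, t < s → w s = k s := fun s hs => if_neg hs.not_ge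
  have hnear : ∫⁻ s in Ioc 0 r, ENNReal.ofReal (w s ^ q) ≤
      ENNReal.ofReal (Real.log (r / t) + c) := by
    have h1 : ∫⁻ s in Ioc 0 t, ENNReal.ofReal (w s ^ q) = ENNReal.ofReal (a ^ q) := by
      rw [setLIntegral_congr_fun measurableSet_Ioc
        (g := fun _ => ENNReal.ofReal (a ^ q * t⁻¹)) fun s hs => ?_]
      · rw [setLIntegral_const, Real.volume_Ioc, ← ENNReal.ofReal_mul (by positivity), sub_zero,
          inv_mul_cancel_right₀ ht.ne']
      · simp only
        rw [hwt s hs.2, Real.mul_rpow ha0 (by positivity), ← Real.rpow_mul ht.le, neg_mul,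
          inv_mul_cancel₀ (by linarith), Real.rpow_neg_one]
    have h2 : ∫⁻ s in Ioc t r, ENNReal.ofReal (w s ^ q) ≤
        ENNReal.ofReal (Real.log (r / t) + m) := by
      rw [setLIntegral_congr_fun measurableSet_Ioc
        (g := fun s => ENNReal.ofReal (k s ^ q)) fun s hs => by simp only [hwk s hs.1]]
      exact lintegral_rpow_Ioc_le hq hK hε ht htr hrT hk0 hk
    rw [← Ioc_union_Ioc_eq_Ioc ht.le htr]
    refine (lintegral_union_le _ _ _).trans ((add_le_add h1.le h2).trans ?_)
    rw [← ENNReal.ofReal_add (by positivity) (by positivity)]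
    exact ENNReal.ofReal_le_ofReal (by linarith)
  have hfar : ∫⁻ s in Ioi r, ENNReal.ofReal (w s ^ q) ≤
      ENNReal.ofReal (Real.log (T / r) + c) := by
    rw [setLIntegral_congr_fun measurableSet_Ioi
      (g := fun s => ENNReal.ofReal (k s ^ q))
        fun s hs => by simp only [hwk s (htr.trans_lt hs)],
      ← Ioc_union_Ioi_eq_Ioi hrT]
    refine (lintegral_union_le _ _ _).trans ((add_le_add
      (lintegral_rpow_Ioc_le hq hK hε hr hrT le_rfl hk0 hk) hkT).trans ?_)
    rw [← ENNReal.ofReal_add (by positivity) hb]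
    refine ENNReal.ofReal_le_ofReal ?_
    have : 0 ≤ a ^ q := by positivity
    linarith
  have hfirst : 1 / t * (∫ s in Ioc 0 t, g s) * (∫ s in Ioc 0 t, k s) ≤
      ∫ s in Ioc 0 t, a * t ^ (-q⁻¹) * g s := by
    rw [integral_const_mul]
    have := average_Ioc_le hpq hK hε ht (htr.trans hrT) hk0 hk
    have hG : 0 ≤ ∫ s in Ioc 0 t, g s := integral_nonneg hg0
    nlinarith
  have hIr0 : 0 ≤ 1 - I.toReal := by linarith
  have hlow : ENNReal.ofReal (∫ s in Ioc 0 t, a * t ^ (-q⁻¹) * g s) ≤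
      ∫⁻ s in Ioc 0 t, ENNReal.ofReal (w s * g s) := by
    refine (ofReal_integral_le_lintegral_ofReal fun s => by have := hg0 s; positivity).trans_eq ?_
    exact setLIntegral_congr_fun measurableSet_Ioc fun s hs => by simp only [hwt s hs.2]
  have hhigh : ENNReal.ofReal (∫ s in Ioi t, g s * k s) ≤
      ∫⁻ s in Ioi t, ENNReal.ofReal (w s * g s) := by
    refine (ofReal_integral_le_lintegral_ofReal fun s => mul_nonneg (hg0 s) (hk0 s)).trans_eq ?_
    exact setLIntegral_congr_fun measurableSet_Ioi fun s hs => by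
      simp only [hwk s hs, mul_comm (g s)]
  refine (ENNReal.ofReal_le_ofReal_iff (by positivity)).1 ?_
  calc _ ≤ ENNReal.ofReal ((∫ s in Ioc 0 t, a * t ^ (-q⁻¹) * g s) + ∫ s in Ioi t, g s * k s) :=
        ENNReal.ofReal_le_ofReal (by linarith)
    _ ≤ (∫⁻ s in Ioc 0 t, ENNReal.ofReal (w s * g s)) +
        ∫⁻ s in Ioi t, ENNReal.ofReal (w s * g s) :=
      ENNReal.ofReal_add_le.trans (add_le_add hlow hhigh)
    _ = (∫⁻ s in Ioi r, ENNReal.ofReal (w s * g s)) +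
        ∫⁻ s in Ioc 0 r, ENNReal.ofReal (w s * g s) := by
      rw [← lintegral_union measurableSet_Ioi (Ioc_disjoint_Ioi le_rfl),
        Ioc_union_Ioi_eq_Ioi ht.le, add_comm,
        ← lintegral_union measurableSet_Ioi (Ioc_disjoint_Ioi le_rfl),
        Ioc_union_Ioi_eq_Ioi hr.le]
    _ ≤ ENNReal.ofReal ((Real.log (T / r) + c) ^ q⁻¹ * (1 - I.toReal) ^ p⁻¹) +
        ENNReal.ofReal ((Real.log (r / t) + c) ^ q⁻¹ * I.toReal ^ p⁻¹) :=
      add_le_add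
        (lintegral_ofReal_mul_le_of_holder hpq hwm hg hw0 hg0 (by positivity) hIr0 hfar hIrest)
        (lintegral_ofReal_mul_le_of_holder hpq hwm hg hw0 hg0 (by positivity)
          ENNReal.toReal_nonneg hnear (ENNReal.ofReal_toReal hItop).ge)
    _ = _ := (ENNReal.ofReal_add (by positivity) (by positivity)).symm

/-- Rearrangement-level form of the local Adams inequality: with `p' = p/(p−1)`,
if `∫_0^∞ g^p ≤ 1`, `β^{1/p'} t^{1/p'} h(t) ≤ 1 + K t^ε` on `(0,T]` and
`∫_T^∞ h^{p'} ≤ b₁`, then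
`(1/T) ∫_0^T exp(β [(1/t)∫_0^t g ∫_0^t h + ∫_t^∞ g h]^{p'}) dt ≤ C`
with `C` depending only on `p, β, T, K, ε, b₁`. -/
theorem adams_rearranged (p β T K ε b₁ : ℝ) (hp : 1 < p) (hβ : 0 < β) (hT : 0 < T)
    (hK : 0 ≤ K) (hε : 0 < ε) (hb₁ : 0 ≤ b₁) :
    ∃ C : ℝ, 0 < C ∧ ∀ g h : ℝ → ℝ, Measurable g → Measurable h →
      (∀ s, 0 ≤ g s) → (∀ s, 0 ≤ h s) →
      (∫⁻ s in Ioi (0 : ℝ), ENNReal.ofReal (g s ^ p)) ≤ 1 →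
      (∀ t : ℝ, 0 < t → t ≤ T →
        β ^ ((p - 1) / p) * t ^ ((p - 1) / p) * h t ≤ 1 + K * t ^ ε) →
      (∫⁻ t in Ioi T, ENNReal.ofReal (h t ^ (p / (p - 1)))) ≤ ENNReal.ofReal b₁ →
      (∫⁻ t in Ioc (0 : ℝ) T, ENNReal.ofReal (Real.exp (β *
          ((1 / t) * (∫ s in Ioc (0 : ℝ) t, g s) * (∫ s in Ioc (0 : ℝ) t, h s) +
            ∫ s in Ioi t, g s * h s) ^ (p / (p - 1))))) ≤ ENNReal.ofReal (C * T) := by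
  have hpq : p.HolderConjugate (p / (p - 1)) := Real.HolderConjugate.conjExponent hp
  set q := p / (p - 1) with hq
  have hqinv : (p - 1) / p = q⁻¹ := (inv_div _ _).symm
  have hq0 := hpq.symm.pos
  have hp0 := hpq.pos
  simp only [hqinv]
  obtain ⟨c, hc⟩ : ∃ c, c = ((1 + K * T ^ ε) * p) ^ q + ((1 + K * T ^ ε) ^ q - 1) / ε + β * b₁ :=
    ⟨_, rfl⟩
  have hc0 : 0 < c := by
    have h1 : 1 ≤ (1 + K * T ^ ε) ^ q := Real.one_le_rpow
      (le_add_of_nonneg_right (by positivity)) hq0.le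
    have h2 : 0 ≤ ((1 + K * T ^ ε) ^ q - 1) / ε := div_nonneg (by linarith) hε.le
    rw [hc]
    positivity
  obtain ⟨C, hC, H⟩ := exists_lintegral_exp_rpow_le hpq hc0 hT
  refine ⟨C, hC, fun g h hg hh hg0 hh0 hgp hhT hhb => ?_⟩
  set k : ℝ → ℝ := fun s => β ^ q⁻¹ * h s with hkdef
  have hk0 : ∀ s, 0 ≤ k s := fun s => mul_nonneg (by positivity) (hh0 s)
  have hkm : Measurable k := hh.const_mul _
  have hk : ∀ s, 0 < s → s ≤ T → k s ≤ (1 + K * s ^ ε) * s ^ (-q⁻¹) := fun s hs hsT => by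
    rw [Real.rpow_neg hs.le, ← div_eq_mul_inv, le_div_iff₀ (by positivity)]
    linarith [hhT s hs hsT]
  have hβq : (β ^ q⁻¹) ^ q = β := Real.rpow_inv_rpow hβ.le hq0.ne'
  have hkT : ∫⁻ s in Ioi T, ENNReal.ofReal (k s ^ q) ≤ ENNReal.ofReal (β * b₁) := by
    simp only [hkdef, Real.mul_rpow (Real.rpow_nonneg hβ.le _) (hh0 _), hβq,
      ENNReal.ofReal_mul hβ.le]
    rw [lintegral_const_mul _ (by fun_prop)]
    gcongr
  have hl1 : ∀ r, (∫⁻ s in Ioc 0 r, ENNReal.ofReal (g s ^ p)).toReal ≤ 1 := fun r =>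
    ENNReal.toReal_le_of_le_ofReal zero_le_one
      (by simpa using (lintegral_mono_set Ioc_subset_Ioi_self).trans hgp)
  set u : ℝ → ℝ := fun t =>
    |1 / t * (∫ s in Ioc 0 t, g s) * (∫ s in Ioc 0 t, k s) + ∫ s in Ioi t, g s * k s| with hu
  have hu_of_pos : ∀ t, 0 < t → u t =
      1 / t * (∫ s in Ioc 0 t, g s) * (∫ s in Ioc 0 t, k s) + ∫ s in Ioi t, g s * k s :=
    fun t ht => abs_of_nonneg (add_nonneg (mul_nonneg (mul_nonneg (by positivity)
      (integral_nonneg hg0)) (integral_nonneg hk0))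
      (integral_nonneg fun s => mul_nonneg (hg0 s) (hk0 s)))
  refine le_trans (setLIntegral_mono' measurableSet_Ioc fun t ht => ?_)
    (H u (fun r => (∫⁻ s in Ioc 0 r, ENNReal.ofReal (g s ^ p)).toReal) (fun t => abs_nonneg _)
      (fun r => ENNReal.toReal_nonneg) hl1 fun t r ht htr hrT => ?_)
  · have hfac : u t = β ^ q⁻¹ * ((1 / t) * (∫ s in Ioc (0 : ℝ) t, g s) *
        (∫ s in Ioc (0 : ℝ) t, h s) + ∫ s in Ioi t, g s * h s) := by
      rw [hu_of_pos t ht.1]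
      simp only [hkdef, integral_const_mul, mul_left_comm (g _)]
      ring
    have ht0 := ht.1
    rw [hfac, Real.mul_rpow (by positivity) (add_nonneg (mul_nonneg (mul_nonneg (by positivity)
      (integral_nonneg hg0)) (integral_nonneg hh0))
      (integral_nonneg fun s => mul_nonneg (hg0 s) (hh0 s))), hβq]
  · rw [hu_of_pos t ht]
    exact oneil_bound_le hpq hK hε (by positivity) ht htr hrT hg hkm hg0 hk0 hgp hk hkT hc
end
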